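/- arXiv:2402.15233 — 5 statements merged into one kernel-verified Lean document; each statement's English description precedes it below -/
import Mathlib

section
/- Let T be a finite partially ordered set, let G = {t ∈ T : ∃ t′ ∈ T, t ≺ t′}, and let f : G → T be a delay function, i.e., t ≺ f(t) for all t ∈ G. Define, for every cut C of T, χ_f(C) = ⋃_{t ∈ G, f(t) ∈ C} T^{≼t}. Then χ_f maps cuts of T to cuts of T and is a causality function; explicitly: (1) χ_f(C ∪ D) = χ_f(C) ∪ χ_f(D) for all cuts C, D; (2) if C ⊆ D are cuts then χ_f(C) ⊆ χ_f(D); (3) for every nonempty bounded cut C, χ_f(C) is a proper subset of C; (4) for every bounded cut C and every t ∈ C there exists n ∈ ℕ such that t ∉ χ_fⁿ(C) (the n-fold iterate of χ_f applied to C). -/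
/-- A subset `C` of a partially ordered set is a *cut* if `C = ⋃_{t ∈ C} {x | x ≤ t}`. -/
def IsCut {α : Type*} [PartialOrder α] (C : Set α) : Prop :=
  C = ⋃ t ∈ C, {x | x ≤ t}

/-- The causality function `χ_f` induced by a delay function `f`:
`χ_f(C) = ⋃_{t ∈ G, f t ∈ C} {x | x ≤ t}` where `G = {t | ∃ t', t < t'}`. -/
def chiF {α : Type*} [PartialOrder α] (f : α → α) (C : Set α) : Set α :=
  {x | ∃ t, (∃ t', t < t') ∧ f t ∈ C ∧ x ≤ t}

theorem isCut_iff_isLowerSet {α : Type*} [PartialOrder α] {C : Set α} :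
    IsCut C ↔ IsLowerSet C := by
  constructor
  · intro h a b hba ha
    rw [h]
    exact Set.mem_biUnion ha hba
  · intro h
    ext x
    simp only [Set.mem_iUnion, Set.mem_ofPred_eq, exists_prop]
    exact ⟨fun hx => ⟨x, hx, le_rfl⟩, fun ⟨_, ht, hxt⟩ => h hxt ht⟩

theorem isLowerSet_chiF {α : Type*} [PartialOrder α] (f : α → α) (C : Set α) :
    IsLowerSet (chiF f C) :=
  fun _ _ hba ⟨t, ht, hft, hat⟩ => ⟨t, ht, hft, hba.trans hat⟩

theorem chiF_union {α : Type*} [PartialOrder α] (f : α → α) (C D : Set α) :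
    chiF f (C ∪ D) = chiF f C ∪ chiF f D := by
  ext x
  simp only [chiF, Set.mem_union, Set.mem_ofPred_eq, or_and_right, and_or_left, exists_or]

theorem chiF_mono {α : Type*} [PartialOrder α] (f : α → α) : Monotone (chiF f) :=
  fun _ _ h _ ⟨t, ht, hft, hxt⟩ => ⟨t, ht, h hft, hxt⟩

/-- A delay function shrinks every nonempty finite lower set strictly: it loses all its maximal
elements. -/
theorem chiF_ssubset {α : Type*} [PartialOrder α] {f : α → α}
    (hf : ∀ t, (∃ t', t < t') → t < f t) {C : Set α} (hC : IsLowerSet C) (hfin : C.Finite)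
    (hne : C.Nonempty) : chiF f C ⊂ C := by
  obtain ⟨m, hm⟩ := hfin.exists_maximal hne
  refine (Set.ssubset_iff_of_subset ?_).2 ⟨m, hm.prop, ?_⟩
  · rintro x ⟨t, ht, hft, hxt⟩
    exact hC (hxt.trans (hf t ht).le) hft
  · rintro ⟨t, ht, hft, hmt⟩
    exact hm.not_gt hft (hmt.trans_lt (hf t ht))

theorem exists_iterate_chiF_eq_empty {α : Type*} [Finite α] [PartialOrder α] {f : α → α}
    (hf : ∀ t, (∃ t', t < t') → t < f t) (C : Set α) (hC : IsLowerSet C) :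
    ∃ n : ℕ, (chiF f)^[n] C = ∅ := by
  induction C using WellFoundedLT.induction with
  | ind C ih =>
    obtain rfl | hne := C.eq_empty_or_nonempty
    · exact ⟨0, rfl⟩
    · obtain ⟨n, hn⟩ := ih _ (chiF_ssubset hf hC C.toFinite hne) (isLowerSet_chiF f C)
      exact ⟨n + 1, hn⟩

/-- Let `T` be a finite partially ordered set and `f` a delay function on
`G = {t | ∃ t', t < t'}`, i.e. `t < f t` for all `t ∈ G`.  Then `χ_f` maps cuts to
cuts and is a causality function: it commutes with unions of cuts, is monotone,
maps every nonempty bounded cut to a proper subset of itself, and every element of a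
bounded cut eventually escapes under iteration of `χ_f`. -/
theorem chiF_causality {α : Type*} [Fintype α] [PartialOrder α]
    (f : α → α) (hf : ∀ t, (∃ t', t < t') → t < f t) :
    (∀ C : Set α, IsCut C → IsCut (chiF f C)) ∧
    (∀ C D : Set α, IsCut C → IsCut D → chiF f (C ∪ D) = chiF f C ∪ chiF f D) ∧
    (∀ C D : Set α, IsCut C → IsCut D → C ⊆ D → chiF f C ⊆ chiF f D) ∧
    (∀ C : Set α, IsCut C → C.Nonempty → (∃ t, C ⊆ {x | x ≤ t}) → chiF f C ⊂ C) ∧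
    (∀ C : Set α, IsCut C → (∃ t, C ⊆ {x | x ≤ t}) →
      ∀ t ∈ C, ∃ n : ℕ, t ∉ (chiF f)^[n] C) := by
  refine ⟨fun C _ => isCut_iff_isLowerSet.2 (isLowerSet_chiF f C), fun C D _ _ => chiF_union f C D,
    fun C D _ _ h => chiF_mono f h, fun C hC hne _ =>
      chiF_ssubset hf (isCut_iff_isLowerSet.1 hC) C.toFinite hne, fun C hC _ t _ => ?_⟩
  obtain ⟨n, hn⟩ := exists_iterate_chiF_eq_empty hf C (isCut_iff_isLowerSet.1 hC)
  exact ⟨n, hn ▸ Set.notMem_empty t⟩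
end

section
/- For every m ≥ 1 and every strictly increasing sequence of positive integers a₁ < a₂ < … < a_m, one has Σ_{i=1}^m (a_i − 2i + 2) · 2^{1−a_i} ≤ 2, where the terms are taken in ℝ (the factor a_i − 2i + 2 may be negative). -/
/-- A supersolution of the optimal-stopping recursion
`U d = max (d + 1 + U (d - 1) / 2) (U (d + 1) / 2)`. -/
noncomputable def delayPotential (d : ℤ) : ℝ :=
  if 0 ≤ d then 2 * (d : ℝ) + 2 else (2 : ℝ) ^ (d + 1)

theorem delayPotential_nonneg (d : ℤ) : 0 ≤ delayPotential d := by
  unfold delayPotential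
  split_ifs with h
  · have : (0 : ℝ) ≤ d := by exact_mod_cast h
    linarith
  · positivity

theorem delayPotential_add_one_le (d : ℤ) :
    delayPotential (d + 1) ≤ 2 * delayPotential d := by
  unfold delayPotential
  rcases lt_trichotomy d (-1) with h | rfl | h
  · rw [if_neg (by lia), if_neg (by lia), zpow_add_one₀ two_ne_zero (d + 1)]
    linarith
  · norm_num
  · have : (0 : ℝ) ≤ d := by exact_mod_cast (by lia : (0 : ℤ) ≤ d)
    rw [if_pos (by lia), if_pos (by lia)]
    push_cast
    linarith

theorem add_delayPotential_sub_one_le (d : ℤ) :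
    2 * ((d : ℝ) + 1) + delayPotential (d - 1) ≤ 2 * delayPotential d := by
  unfold delayPotential
  rcases lt_trichotomy d 0 with h | rfl | h
  · have h1 : (d : ℝ) + 1 ≤ 0 := by exact_mod_cast (by lia : d + 1 ≤ 0)
    have h2 : (0 : ℝ) < 2 ^ d := by positivity
    rw [if_neg (by lia), if_neg (by lia), sub_add_cancel, zpow_add_one₀ two_ne_zero d]
    linarith
  · norm_num
  · rw [if_pos (by lia), if_pos (by lia)]
    push_cast
    linarith

/-- The partial sum plus the discounted potential stays below `2`. -/
theorem sum_delay_add_potential_le (a : ℕ → ℕ) (m : ℕ)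
    (hpos : ∀ i ∈ Finset.Icc 1 m, 1 ≤ a i)
    (hmono : ∀ i j, 1 ≤ i → i < j → j ≤ m → a i < a j)
    (t : ℕ) (ht : ∀ i ∈ Finset.Icc 1 m, a i ≤ t) :
    ∑ i ∈ Finset.Icc 1 m,
        ((a i : ℝ) - 2 * (i : ℝ) + 2) * (2 : ℝ) ^ ((1 : ℤ) - (a i : ℤ)) +
      (2 : ℝ) ^ (-(t : ℤ)) * delayPotential ((t : ℤ) - 2 * (m : ℤ)) ≤ 2 := by
  have skip (s k : ℕ) :
      (2 : ℝ) ^ (-((s + 1 : ℕ) : ℤ)) * delayPotential (((s + 1 : ℕ) : ℤ) - 2 * (k : ℤ)) ≤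
        (2 : ℝ) ^ (-(s : ℤ)) * delayPotential ((s : ℤ) - 2 * (k : ℤ)) := by
    have h1 : (2 : ℝ) ^ (-(s : ℤ)) = 2 ^ (-((s + 1 : ℕ) : ℤ)) * 2 := by
      rw [← zpow_add_one₀ two_ne_zero]
      congr 1
      push_cast
      ring
    have h2 : ((s + 1 : ℕ) : ℤ) - 2 * (k : ℤ) = ((s : ℤ) - 2 * k) + 1 := by
      push_cast
      ring
    rw [h1, h2, mul_assoc]
    exact mul_le_mul_of_nonneg_left (delayPotential_add_one_le _) (by positivity)
  induction m generalizing t with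
  | zero =>
    clear ht
    induction t with
    | zero => simp [delayPotential]
    | succ s ih => linarith [skip s 0]
  | succ m ih =>
    have hle : a (m + 1) ≤ t := ht _ (by simp)
    clear ht
    induction t, hle using Nat.le_induction with
    | succ s _ ihs => linarith [skip s (m + 1)]
    | base =>
      obtain ⟨s, hs⟩ : ∃ s, a (m + 1) = s + 1 :=
        Nat.exists_eq_add_of_le' (hpos _ (by simp))
      have key := ih (fun i hi => hpos i (by simp at hi ⊢; lia))
        (fun i j h1 h2 h3 => hmono i j h1 h2 (by lia)) s (fun i hi => by
          simp only [Finset.mem_Icc] at hi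
          have := hmono i (m + 1) hi.1 (by lia) le_rfl
          lia)
      have h1 : (2 : ℝ) ^ (-(s : ℤ)) = 2 ^ (-((s + 1 : ℕ) : ℤ)) * 2 := by
        rw [← zpow_add_one₀ two_ne_zero]
        congr 1
        push_cast
        ring
      have h2 : (1 : ℤ) - ((s + 1 : ℕ) : ℤ) = -(s : ℤ) := by
        push_cast
        ring
      have h3 : ((s + 1 : ℕ) : ℤ) - 2 * ((m + 1 : ℕ) : ℤ) = ((s : ℤ) - 2 * m) - 1 := by
        push_cast
        ring
      rw [Finset.sum_Icc_succ_top (by lia), hs, h2, h3]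
      rw [h1] at key ⊢
      have step := mul_le_mul_of_nonneg_left (add_delayPotential_sub_one_le ((s : ℤ) - 2 * m))
        (by positivity : (0 : ℝ) ≤ 2 ^ (-((s + 1 : ℕ) : ℤ)))
      push_cast at step key ⊢
      linarith


/-- For every `m ≥ 1` and every strictly increasing sequence of positive integers
`a₁ < a₂ < … < a_m`, one has `Σ_{i=1}^m (aᵢ − 2i + 2) · 2^(1−aᵢ) ≤ 2`, the terms
being taken in `ℝ`. -/
theorem sum_delay_bound (m : ℕ) (hm : 1 ≤ m) (a : ℕ → ℕ)
    (hpos : ∀ i ∈ Finset.Icc 1 m, 1 ≤ a i)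
    (hmono : ∀ i j, 1 ≤ i → i < j → j ≤ m → a i < a j) :
    ∑ i ∈ Finset.Icc 1 m,
      ((a i : ℝ) - 2 * (i : ℝ) + 2) * (2 : ℝ) ^ ((1 : ℤ) - (a i : ℤ)) ≤ 2 := by
  have h := sum_delay_add_potential_le a m hpos hmono (a m) (fun i hi => by
    simp only [Finset.mem_Icc] at hi
    rcases hi.2.eq_or_lt with rfl | hlt
    · exact le_rfl
    · exact (hmono i m hi.1 hlt le_rfl).le)
  have h0 : 0 ≤ (2 : ℝ) ^ (-(a m : ℤ)) * delayPotential ((a m : ℤ) - 2 * (m : ℤ)) :=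
    mul_nonneg (by positivity) (delayPotential_nonneg _)
  linarith
end

section
/- Let n ≥ 1, ε ∈ [0, 1/2], and b ∈ {0,1}ⁿ. Let μ be a probability measure on {0,1}ⁿ (the joint distribution of bits C₁, …, Cₙ) such that for every i ∈ {1,…,n}, every prefix x ∈ {0,1}^{i−1} with μ[C₁ = x₁, …, C_{i−1} = x_{i−1}] > 0, and every value c ∈ {0,1}: Pr[Cᵢ = c | C₁ = x₁, …, C_{i−1} = x_{i−1}] ≤ 1/2 + ε. Let a₁ < … < a_m enumerate the set {i : bᵢ = 1}. Then Pr[∃ k ∈ {1,…,m} : Cⱼ = bⱼ for all j < a_k and C_{a_k} = 0] ≤ Σ_{k=1}^m (1/2 + ε)^{a_k − k + 1} (1/2 − ε)^{k − 1}. -/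
/-- The probability of an event `A ⊆ {0,1}ⁿ` under the distribution with mass
function `p`. -/
noncomputable def prOf {n : ℕ} (p : (Fin n → Bool) → ℝ) (A : Set (Fin n → Bool)) : ℝ :=
  ∑ c : Fin n → Bool, A.indicator p c

/-- The winning bound for the pattern `β` restricted to its first `n` positions. -/
noncomputable def deviationBound (ε : ℝ) (β : ℕ → Bool) (n : ℕ) : ℝ :=
  ∑ i ∈ Finset.range n, if β i = true then
    (1 / 2 + ε) ^ (i - Nat.count (fun j => β j = true) i + 1) *
      (1 / 2 - ε) ^ Nat.count (fun j => β j = true) i else 0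

theorem deviationBound_succ (ε : ℝ) (β : ℕ → Bool) (n : ℕ) :
    deviationBound ε β (n + 1) =
      if β 0 = true then (1 / 2 + ε) + (1 / 2 - ε) * deviationBound ε (fun i => β (i + 1)) n
      else (1 / 2 + ε) * deviationBound ε (fun i => β (i + 1)) n := by
  unfold deviationBound
  rw [Finset.sum_range_succ']
  split_ifs with h
  · rw [Finset.mul_sum, add_comm]
    congr 1
    · simp
    · refine Finset.sum_congr rfl fun i _ => ?_
      split_ifs with hi
      · rw [Nat.count_succ', if_pos h, Nat.add_sub_add_right]
        ring
      · simp
  · rw [Finset.mul_sum, add_zero]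
    refine Finset.sum_congr rfl fun i _ => ?_
    split_ifs with hi
    · have hle := Nat.count_le (p := fun j => β (j + 1) = true) (n := i)
      rw [Nat.count_succ', if_neg h, add_zero, Nat.sub_add_comm hle]
      ring
    · simp

theorem deviationBound_mem_Icc {ε : ℝ} (hε0 : 0 ≤ ε) (hε : ε ≤ 1 / 2) (β : ℕ → Bool) (n : ℕ) :
    deviationBound ε β n ∈ Set.Icc (0 : ℝ) 1 := by
  induction n generalizing β with
  | zero => simp [deviationBound]
  | succ n ih =>
    obtain ⟨h0, h1⟩ := ih fun i => β (i + 1)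
    rw [deviationBound_succ]
    split_ifs <;> constructor <;> nlinarith

theorem sum_le_mul_deviationBound {ε : ℝ} (hε0 : 0 ≤ ε) (hε : ε ≤ 1 / 2) (n : ℕ)
    (β : ℕ → Bool) (Q : ℕ → ℝ)
    (hone : ∀ i < n, β i = true → Q i - Q (i + 1) ≤ (1 / 2 + ε) * Q i)
    (hzero : ∀ i < n, β i = false → Q (i + 1) ≤ (1 / 2 + ε) * Q i) :
    (∑ i ∈ Finset.range n, if β i = true then Q i - Q (i + 1) else 0)
      ≤ Q 0 * deviationBound ε β n := by
  induction n generalizing β Q with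
  | zero => simp [deviationBound]
  | succ n ih =>
    have hrec := ih (fun i => β (i + 1)) (fun i => Q (i + 1))
      (fun i hi => hone (i + 1) (by omega)) (fun i hi => hzero (i + 1) (by omega))
    obtain ⟨h0, h1⟩ := deviationBound_mem_Icc hε0 hε (fun i => β (i + 1)) n
    rw [Finset.sum_range_succ', deviationBound_succ]
    rw [zero_add] at hrec ⊢
    split_ifs with h
    · have := mul_le_mul_of_nonneg_right (hone 0 (by omega) h) (sub_nonneg.2 h1)
      rw [zero_add] at this
      linarith
    · have := mul_le_mul_of_nonneg_right (hzero 0 (by omega) (by simpa using h)) h0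
      rw [zero_add] at this
      linarith

theorem Finset.card_filter_lt_orderIsoOfFin {α : Type*} [LinearOrder α] (s : Finset α)
    (k : Fin s.card) :
    (s.filter (· < (s.orderIsoOfFin rfl k : α))).card = k := by
  have : s.filter (· < (s.orderIsoOfFin rfl k : α)) =
      (Finset.Iio k).map (s.orderEmbOfFin rfl).toEmbedding := by
    ext a
    simp only [Finset.mem_filter, Finset.mem_map, Finset.mem_Iio]
    constructor
    · rintro ⟨ha, hlt⟩
      refine ⟨(s.orderIsoOfFin rfl).symm ⟨a, ha⟩, ?_, ?_⟩
      · rw [OrderIso.symm_apply_lt]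
        exact hlt
      · simp [← Finset.coe_orderIsoOfFin_apply]
    · rintro ⟨l, hl, rfl⟩
      exact ⟨by simp, by simpa using hl⟩
  rw [this, Finset.card_map, Fin.card_Iio]

theorem prOf_nonneg {n : ℕ} {p : (Fin n → Bool) → ℝ} (hp : ∀ c, 0 ≤ p c)
    (A : Set (Fin n → Bool)) : 0 ≤ prOf p A :=
  Finset.sum_nonneg fun _ _ => Set.indicator_nonneg (fun c _ => hp c) _

theorem prOf_mono {n : ℕ} {p : (Fin n → Bool) → ℝ} (hp : ∀ c, 0 ≤ p c)
    {A B : Set (Fin n → Bool)} (h : A ⊆ B) : prOf p A ≤ prOf p B :=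
  Finset.sum_le_sum fun c _ => Set.indicator_le_indicator_of_subset h hp c

theorem prOf_union {n : ℕ} (p : (Fin n → Bool) → ℝ) {A B : Set (Fin n → Bool)}
    (h : Disjoint A B) : prOf p (A ∪ B) = prOf p A + prOf p B := by
  simp only [prOf, Set.indicator_union_of_disjoint h, Finset.sum_add_distrib]

theorem prOf_exists_le {n : ℕ} {ι : Type*} [Fintype ι] {p : (Fin n → Bool) → ℝ}
    (hp : ∀ c, 0 ≤ p c) (A : ι → Set (Fin n → Bool)) :
    prOf p {c | ∃ i, c ∈ A i} ≤ ∑ i, prOf p (A i) := by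
  unfold prOf
  rw [Finset.sum_comm]
  refine Finset.sum_le_sum fun c _ => ?_
  have hnn : ∀ i, 0 ≤ (A i).indicator p c := fun i => Set.indicator_nonneg (fun c _ => hp c) c
  refine Set.indicator_apply_le' ?_ fun _ => Finset.sum_nonneg fun i _ => hnn i
  rintro ⟨i, hi⟩
  rw [← Set.indicator_of_mem hi p]
  exact Finset.single_le_sum (f := fun i => (A i).indicator p c) (fun i _ => hnn i)
    (Finset.mem_univ i)

/-- Let `μ` (mass function `p`) be a joint distribution of bits `C₁, …, Cₙ` such that
every conditional bit, given any positive-probability prefix, takes each value with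
probability at most `1/2 + ε`.  Let `a₁ < … < a_m` enumerate the one-positions of
`b`.  Then the probability that the bit string first deviates from `b` at a
one-position `a_k`, taking value `0` there, is at most
`Σ_{k=1}^m (1/2 + ε)^{a_k − k + 1} (1/2 − ε)^{k − 1}`.
(Here positions are 0-based: `a_k = position + 1`, `k = index + 1`, so the exponents
are `position − index + 1` and `index`.) -/
theorem alice_win_prob_le (n : ℕ) (hn : 1 ≤ n) (ε : ℝ) (hε0 : 0 ≤ ε) (hε : ε ≤ 1 / 2)
    (b : Fin n → Bool) (p : (Fin n → Bool) → ℝ)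
    (hp0 : ∀ c, 0 ≤ p c) (hp1 : ∑ c, p c = 1)
    (hcond : ∀ (i : Fin n) (x : Fin n → Bool) (v : Bool),
      0 < prOf p {c | ∀ j, j < i → c j = x j} →
      prOf p {c | c i = v ∧ ∀ j, j < i → c j = x j} /
        prOf p {c | ∀ j, j < i → c j = x j} ≤ 1 / 2 + ε) :
    prOf p {c | ∃ i, b i = true ∧ c i = false ∧ ∀ j, j < i → c j = b j}
      ≤ ∑ k : Fin (Finset.univ.filter fun i => b i = true).card,
          (1 / 2 + ε) ^
            ((((Finset.univ.filter fun i => b i = true).orderIsoOfFin rfl k : Fin n) : ℕ)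
              - (k : ℕ) + 1)
          * (1 / 2 - ε) ^ (k : ℕ) := by
  let β : ℕ → Bool := fun i => if h : i < n then b ⟨i, h⟩ else false
  have hβ : ∀ i : Fin n, β i = b i := fun i => by simp [β]
  let Q : ℕ → ℝ := fun i => prOf p {c | ∀ j : Fin n, (j : ℕ) < i → c j = b j}
  let E : Fin n → Set (Fin n → Bool) := fun i => {c | c i = false ∧ ∀ j, j < i → c j = b j}
  have hE : ∀ i : Fin n, prOf p (E i) ≤ (1 / 2 + ε) * Q i := by
    intro i
    rcases (prOf_nonneg hp0 {c | ∀ j, j < i → c j = b j}).eq_or_lt with h | h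
    · have hQ : Q i = 0 := h.symm
      have hle : prOf p (E i) ≤ Q i := prOf_mono hp0 fun c hc => hc.2
      rw [hQ] at hle ⊢
      simpa using hle
    · exact (div_le_iff₀ h).1 (hcond i b false h)
  have hsucc : ∀ i : Fin n, {c : Fin n → Bool | ∀ j : Fin n, (j : ℕ) < i + 1 → c j = b j} =
      {c | c i = b i ∧ ∀ j, j < i → c j = b j} := by
    intro i
    ext c
    refine ⟨fun h => ⟨h i (by omega), fun j hj => h j (by omega)⟩, fun h j hj => ?_⟩
    rcases (show j ≤ i by omega).eq_or_lt with rfl | hlt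
    · exact h.1
    · exact h.2 j hlt
  have hQone : ∀ i : Fin n, b i = true → Q i - Q (i + 1) = prOf p (E i) := by
    intro i hi
    have hdisj : Disjoint (E i) {c | c i = b i ∧ ∀ j, j < i → c j = b j} := by
      rw [Set.disjoint_left]
      rintro c ⟨h, -⟩ ⟨h', -⟩
      simp_all
    have hunion : {c : Fin n → Bool | ∀ j : Fin n, (j : ℕ) < i → c j = b j} =
        E i ∪ {c | c i = b i ∧ ∀ j, j < i → c j = b j} := by
      ext c
      cases hc : c i <;> simp [E, hc, hi]
    simp only [Q, hsucc, hunion, prOf_union p hdisj, add_sub_cancel_right]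
  have hQzero : ∀ i : Fin n, b i = false → Q (i + 1) = prOf p (E i) := by
    intro i hi
    simp only [Q, hsucc, E, hi]
  have hQ0 : Q 0 = 1 := by simp [Q, prOf, hp1]
  have hbound := sum_le_mul_deviationBound hε0 hε n β Q
    (fun i hi hb => by
      rw [hβ ⟨i, hi⟩] at hb
      exact (hQone ⟨i, hi⟩ hb).trans_le (hE ⟨i, hi⟩))
    (fun i hi hb => by
      rw [hβ ⟨i, hi⟩] at hb
      exact (hQzero ⟨i, hi⟩ hb).trans_le (hE ⟨i, hi⟩))
  rw [hQ0, one_mul, Finset.sum_range, deviationBound, Finset.sum_range] at hbound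
  simp only [hβ] at hbound
  have hcount : ∀ i : Fin n, Nat.count (fun j => β j = true) i =
      ((Finset.univ.filter fun i => b i = true).filter (· < i)).card := by
    intro i
    rw [Nat.count_eq_card_filter_range, ← Finset.card_map Fin.valEmbedding]
    congr 1
    ext j
    simp only [Finset.mem_filter, Finset.mem_range, Finset.mem_map, Finset.mem_univ, true_and,
      Fin.valEmbedding_apply]
    constructor
    · rintro ⟨hj, hb⟩
      exact ⟨⟨j, hj.trans i.2⟩, ⟨(hβ ⟨j, hj.trans i.2⟩).symm.trans hb, hj⟩, rfl⟩
    · rintro ⟨l, ⟨hb, hl⟩, rfl⟩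
      exact ⟨hl, (hβ l).trans hb⟩
  calc prOf p {c | ∃ i, b i = true ∧ c i = false ∧ ∀ j, j < i → c j = b j}
      ≤ ∑ i, prOf p {c | b i = true ∧ c ∈ E i} :=
        prOf_exists_le hp0 fun i => {c | b i = true ∧ c ∈ E i}
    _ = ∑ i : Fin n, if b i = true then Q i - Q (i + 1) else 0 := by
        refine Finset.sum_congr rfl fun i _ => ?_
        split_ifs with hi
        · simp [hQone i hi, hi]
        · simp [hi, prOf]
    _ ≤ _ := hbound
    _ = _ := by
        rw [← Finset.sum_filter, ← Finset.sum_coe_sort,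
          ← Equiv.sum_comp ((Finset.univ.filter fun i => b i = true).orderIsoOfFin rfl).toEquiv]
        refine Finset.sum_congr rfl fun k _ => ?_
        simp only [hcount, RelIso.coe_fn_toEquiv, Finset.card_filter_lt_orderIsoOfFin]
end

section
/- Fix z ∈ (0, 1/2] and ε ∈ [0, z]. (i) Let c′ be a random bit with Pr[c′ = 0] = z, and let the adversary choose bits (b′, p′), possibly at random and depending on c′. The output bit c_B is defined as follows: if p′ = 1 then c_B = 1; otherwise c_B = b′ with probability ε/(1−z) and c_B = c′ with probability 1 − ε/(1−z), this randomization being independent of everything else. Then for every adversarial strategy Pr[c_B = 0] ≤ z + ε, and the strategy that always outputs b′ = 0, p′ = 0 achieves Pr[c_B = 0] = z + ε. (ii) Let c″ be a random bit with Pr[c″ = 0] = z, and let the adversary choose bits (b″, p″), possibly at random and depending on c″. The output bit c_A is defined as follows: if p″ = 1 then c_A = 0; otherwise c_A = b″ with probability ε/z and c_A = c″ with probability 1 − ε/z, independently of everything else. Then for every adversarial strategy Pr[c_A = 1] ≤ 1 − z + ε, and the strategy that always outputs b″ = 1, p″ = 0 achieves Pr[c_A = 1] = 1 − z + ε. -/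
/-- Distribution of the nominal bit: `Pr[bit = 0] = z`, `Pr[bit = 1] = 1 − z`
(`false` encodes `0`, `true` encodes `1`). -/
def pBit (z : ℝ) (c : Bool) : ℝ := if c then 1 - z else z

/-- The probability that the honest output `c_B` of the resource `S_A` equals `0`,
when the dishonest party uses the strategy `strat` (a probability kernel from the
observed bit `c'` to the pair `(b', p')`): if `p' = 1` then `c_B = 1`; otherwise
`c_B = b'` with probability `ε/(1−z)` and `c_B = c'` with probability
`1 − ε/(1−z)`. -/
noncomputable def prCB0 (z ε : ℝ) (strat : Bool → Bool × Bool → ℝ) : ℝ :=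
  ∑ c' : Bool, pBit z c' *
    ∑ bp : Bool × Bool, strat c' bp *
      (if bp.2 then 0
       else (ε / (1 - z)) * (if bp.1 then 0 else 1)
            + (1 - ε / (1 - z)) * (if c' then 0 else 1))

/-- The probability that the honest output `c_A` of the resource `S_B` equals `1`,
when the dishonest party uses the strategy `strat` (kernel from the observed bit `c''`
to `(b'', p'')`): if `p'' = 1` then `c_A = 0`; otherwise `c_A = b''` with probability
`ε/z` and `c_A = c''` with probability `1 − ε/z`. -/
noncomputable def prCA1 (z ε : ℝ) (strat : Bool → Bool × Bool → ℝ) : ℝ :=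
  ∑ c'' : Bool, pBit z c'' *
    ∑ bp : Bool × Bool, strat c'' bp *
      (if bp.2 then 0
       else (ε / z) * (if bp.1 then 1 else 0)
            + (1 - ε / z) * (if c'' then 1 else 0))

/-- A weighted average of numbers bounded by `M` is at most `M`. -/
theorem sum_mul_le_of_forall_le {ι : Type*} [Fintype ι] {w f : ι → ℝ} {M : ℝ}
    (hw : ∀ i, 0 ≤ w i) (hw1 : ∑ i, w i = 1) (hf : ∀ i, f i ≤ M) :
    ∑ i, w i * f i ≤ M :=
  calc ∑ i, w i * f i ≤ ∑ i, w i * M :=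
        Finset.sum_le_sum fun i _ => mul_le_mul_of_nonneg_left (hf i) (hw i)
    _ = M := by rw [← Finset.sum_mul, hw1, one_mul]

theorem prCB0_le {z ε : ℝ} (hz0 : 0 ≤ z) (hz1 : z < 1) (hε0 : 0 ≤ ε) (hε : ε ≤ 1 - z)
    {strat : Bool → Bool × Bool → ℝ} (h0 : ∀ c bp, 0 ≤ strat c bp)
    (h1 : ∀ c, ∑ bp : Bool × Bool, strat c bp = 1) : prCB0 z ε strat ≤ z + ε := by
  have hz' : 0 < 1 - z := sub_pos.2 hz1
  have hq0 : 0 ≤ ε / (1 - z) := div_nonneg hε0 hz'.le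
  have hq1 : ε / (1 - z) ≤ 1 := (div_le_one hz').2 hε
  calc prCB0 z ε strat
      ≤ ∑ c : Bool, pBit z c * (if c then ε / (1 - z) else 1) := by
        refine Finset.sum_le_sum fun c _ => mul_le_mul_of_nonneg_left
          (sum_mul_le_of_forall_le (h0 c) (h1 c) ?_) ?_
        · rintro ⟨b, p⟩
          cases c <;> cases b <;> cases p <;> simp <;> linarith
        · cases c <;> simp [pBit] <;> linarith
    _ = z + ε := by
        simp [pBit, mul_div_cancel₀ _ hz'.ne', add_comm]

theorem prCA1_le {z ε : ℝ} (hz0 : 0 < z) (hz1 : z ≤ 1) (hε0 : 0 ≤ ε) (hε : ε ≤ z)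
    {strat : Bool → Bool × Bool → ℝ} (h0 : ∀ c bp, 0 ≤ strat c bp)
    (h1 : ∀ c, ∑ bp : Bool × Bool, strat c bp = 1) : prCA1 z ε strat ≤ 1 - z + ε := by
  have hq0 : 0 ≤ ε / z := div_nonneg hε0 hz0.le
  have hq1 : ε / z ≤ 1 := (div_le_one hz0).2 hε
  calc prCA1 z ε strat
      ≤ ∑ c : Bool, pBit z c * (if c then 1 else ε / z) := by
        refine Finset.sum_le_sum fun c _ => mul_le_mul_of_nonneg_left
          (sum_mul_le_of_forall_le (h0 c) (h1 c) ?_) ?_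
        · rintro ⟨b, p⟩
          cases c <;> cases b <;> cases p <;> simp <;> linarith
        · cases c <;> simp [pBit] <;> linarith
    _ = 1 - z + ε := by
        simp [pBit, mul_div_cancel₀ _ hz0.ne']

/-- Cheating-bias properties of the `z`-unbalanced `ε`-biased WCF resource:
(i) every adversarial strategy against `S_A` achieves `Pr[c_B = 0] ≤ z + ε`, and the
deterministic strategy `(b', p') = (0, 0)` attains `Pr[c_B = 0] = z + ε`;
(ii) every adversarial strategy against `S_B` achieves `Pr[c_A = 1] ≤ 1 − z + ε`,
and the deterministic strategy `(b'', p'') = (1, 0)` attains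
`Pr[c_A = 1] = 1 − z + ε`. -/
theorem wcf_resource_bias (z ε : ℝ) (hz0 : 0 < z) (hz : z ≤ 1 / 2)
    (hε0 : 0 ≤ ε) (hεz : ε ≤ z) :
    (∀ strat : Bool → Bool × Bool → ℝ,
      (∀ c bp, 0 ≤ strat c bp) → (∀ c, ∑ bp : Bool × Bool, strat c bp = 1) →
      prCB0 z ε strat ≤ z + ε) ∧
    prCB0 z ε (fun _ bp => if bp = (false, false) then 1 else 0) = z + ε ∧
    (∀ strat : Bool → Bool × Bool → ℝ,
      (∀ c bp, 0 ≤ strat c bp) → (∀ c, ∑ bp : Bool × Bool, strat c bp = 1) →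
      prCA1 z ε strat ≤ 1 - z + ε) ∧
    prCA1 z ε (fun _ bp => if bp = (true, false) then 1 else 0) = 1 - z + ε := by
  have hz' : (1 - z : ℝ) ≠ 0 := by linarith
  refine ⟨fun _ h0 h1 => prCB0_le hz0.le (by linarith) hε0 (by linarith) h0 h1, ?_,
    fun _ h0 h1 => prCA1_le hz0 (by linarith) hε0 hεz h0 h1, ?_⟩
  · simp [prCB0, pBit, Fintype.sum_prod_type]
    field_simp
    ring
  · simp [prCA1, pBit, Fintype.sum_prod_type]
    field_simp
end

section
/- Fix z ∈ (0, 1/2] and ε ∈ [0, z]. Let c′ and c″ be independent random bits, each with Pr[· = 0] = z. Define the (deterministic) man-in-the-middle strategy: if c′ = c″, set (b′, p′) = (c′, 0) and b″ = c″; if (c′, c″) = (0, 1), set p′ = 1 (b′ = 0, say) and b″ = 1; if (c′, c″) = (1, 0), set (b′, p′) = (0, 0) and b″ = 0. The outputs are: c_B = 1 if p′ = 1, and otherwise c_B = b′ with probability ε/(1−z) and c_B = c′ with probability 1 − ε/(1−z); c_A = b″ with probability ε/z and c_A = c″ with probability 1 − ε/z; the two randomizations are independent given (c′, c″). Then the joint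 distribution of (c_A, c_B) is: Pr[(c_A, c_B) = (0, 0)] = z(z + ε), Pr[(c_A, c_B) = (1, 1)] = 1 − z, Pr[(c_A, c_B) = (0, 1)] = z(1 − z − ε), Pr[(c_A, c_B) = (1, 0)] = 0. Consequently Pr[c_A ≠ c_B] = z(1 − z − ε), and the total variation distance between the distribution of (c_A, c_B) and the ideal distribution that assigns probability z to (0, 0) and 1 − z to (1, 1) equals z(1 − z − ε). -/
/-- Conditional distribution of the honest bit `c_B` given `(c', c'')` under the
man-in-the-middle strategy: if `(c', c'') = (0, 1)` the adversary sets `p' = 1`, so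
`c_B = 1`; otherwise `p' = 0` and `b' = c'` if `c' = c''`, `b' = 0` if
`(c', c'') = (1, 0)`, and `c_B = b'` with probability `ε/(1−z)` and `c_B = c'` with
probability `1 − ε/(1−z)`. -/
noncomputable def pCB (z ε : ℝ) (c' c'' y : Bool) : ℝ :=
  if c' = false ∧ c'' = true then (if y then 1 else 0)
  else
    (ε / (1 - z)) * (if y = (if c' = c'' then c' else false) then 1 else 0)
      + (1 - ε / (1 - z)) * (if y = c' then 1 else 0)

/-- Conditional distribution of the honest bit `c_A` given `(c', c'')` under the
man-in-the-middle strategy: the adversary sets `p'' = 0` and `b'' = c''` if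
`c' = c''`, `b'' = 1` if `(c', c'') = (0, 1)`, `b'' = 0` if `(c', c'') = (1, 0)`;
then `c_A = b''` with probability `ε/z` and `c_A = c''` with probability
`1 − ε/z`. -/
noncomputable def pCA (z ε : ℝ) (c' c'' x : Bool) : ℝ :=
  (ε / z) *
      (if x = (if c' = c'' then c'' else (if c' = false then true else false))
        then 1 else 0)
    + (1 - ε / z) * (if x = c'' then 1 else 0)

/-- Joint distribution of `(c_A, c_B)` under the man-in-the-middle attack, with
`c'` and `c''` independent, each equal to `0` with probability `z`, and the two
output randomizations independent given `(c', c'')`. -/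
noncomputable def jointOut (z ε : ℝ) (x y : Bool) : ℝ :=
  ∑ c' : Bool, ∑ c'' : Bool,
    pBit z c' * pBit z c'' * pCA z ε c' c'' x * pCB z ε c' c'' y

/-- The ideal output distribution: `(0,0)` with probability `z`, `(1,1)` with
probability `1 − z`. -/
def idealOut (z : ℝ) (x y : Bool) : ℝ :=
  if x = false ∧ y = false then z else if x = true ∧ y = true then 1 - z else 0

/-- The man-in-the-middle attack on the composition of two `z`-unbalanced `ε`-biased
WCF resources produces outputs `(c_A, c_B)` with joint distribution
`Pr[(0,0)] = z(z+ε)`, `Pr[(1,1)] = 1−z`, `Pr[(0,1)] = z(1−z−ε)`, `Pr[(1,0)] = 0`;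
hence `Pr[c_A ≠ c_B] = z(1−z−ε)` and the total variation distance to the ideal
distribution is `z(1−z−ε)`. -/
theorem mitm_attack_distribution (z ε : ℝ) (hz0 : 0 < z) (hz : z ≤ 1 / 2)
    (hε0 : 0 ≤ ε) (hεz : ε ≤ z) :
    jointOut z ε false false = z * (z + ε) ∧
    jointOut z ε true true = 1 - z ∧
    jointOut z ε false true = z * (1 - z - ε) ∧
    jointOut z ε true false = 0 ∧
    (∑ s : Bool × Bool, if s.1 ≠ s.2 then jointOut z ε s.1 s.2 else 0)
      = z * (1 - z - ε) ∧
    (1 / 2) * (∑ s : Bool × Bool, |jointOut z ε s.1 s.2 - idealOut z s.1 s.2|)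
      = z * (1 - z - ε) := by
  have hz_ne : z ≠ 0 := hz0.ne'
  have hz1_ne : 1 - z ≠ 0 := by linarith
  have h00 : jointOut z ε false false = z * (z + ε) := by
    simp [jointOut, pBit, pCA, pCB]
    field_simp
    ring
  have h11 : jointOut z ε true true = 1 - z := by
    simp [jointOut, pBit, pCA, pCB]
    ring
  have h01 : jointOut z ε false true = z * (1 - z - ε) := by
    simp [jointOut, pBit, pCA, pCB]
    field_simp
  have h10 : jointOut z ε true false = 0 := by
    simp [jointOut, pBit, pCA, pCB]
  have hnonneg : 0 ≤ z * (1 - z - ε) := mul_nonneg hz0.le (by linarith)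
  have habs : |z * (z + ε) - z| = z * (1 - z - ε) := by
    rw [abs_sub_comm, show z - z * (z + ε) = z * (1 - z - ε) by ring, abs_of_nonneg hnonneg]
  refine ⟨h00, h11, h01, h10, ?_, ?_⟩
  · simp [Fintype.sum_prod_type, h01, h10]
  · simp only [Fintype.sum_prod_type, Fintype.sum_bool, h00, h11, h01, h10]
    simp only [idealOut, reduceCtorEq, and_self, and_true, and_false, if_true, if_false,
      sub_self, sub_zero, abs_zero, habs, abs_of_nonneg hnonneg]
    ring
end
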